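/- Let a = (a_ℓ)_{ℓ∈ℤ} be the finitely supported sequence with a_{−1} = −1/16, a₀ = 9/16, a₁ = 9/16, a₂ = −1/16, and a_ℓ = 0 otherwise (the O3 scheme with λ = 1/2). Then there exist constants C > 0 and c > 0 such that for every n ∈ ℕ* and every ℓ ∈ ℤ, | a^{⋆n}_ℓ − n^{−1/4} H_4^{3/128}((ℓ − n/2)/n^{1/4}) + (1/(512 n^{3/4})) (H_4^{3/128})^{(6)}((ℓ − n/2)/n^{1/4}) | ≤ C n^{−5/4} exp( −c (|ℓ − n/2| / n^{1/4})^{4/3} ). -/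

import Mathlib

open Complex

/-- Convolution of two complex-valued sequences over `ℤ`. -/
noncomputable def conv (a b : ℤ → ℂ) : ℤ → ℂ := fun ℓ => ∑' ℓ' : ℤ, a (ℓ - ℓ') * b ℓ'

/-- `iterConv a n` is the iterated convolution `a^{⋆(n+1)}`:
`iterConv a 0 = a^{⋆1} = a` and `iterConv a (n+1) = iterConv a n ⋆ a`. -/
noncomputable def iterConv (a : ℤ → ℂ) : ℕ → ℤ → ℂ
  | 0 => a
  | n + 1 => conv (iterConv a n) a

/-- The generalized Gaussian `H_{2μ}^β (x) = (1/2π) ∫_ℝ e^{-i x θ} e^{-β θ^{2μ}} dθ`. -/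
noncomputable def Hfun (μ : ℕ) (β : ℂ) : ℝ → ℂ :=
  fun x => (1 / (2 * Real.pi : ℂ)) *
    ∫ θ : ℝ, Complex.exp (-Complex.I * x * θ) * Complex.exp (-β * (θ : ℂ) ^ (2 * μ))

/-- The amplification factor sequence of the O3 scheme with `λ = 1/2`. -/
noncomputable def O3half : ℤ → ℂ := fun ℓ =>
  if ℓ = -1 then (-1 / 16 : ℂ)
  else if ℓ = 0 then (9 / 16 : ℂ)
  else if ℓ = 1 then (9 / 16 : ℂ)
  else if ℓ = 2 then (-1 / 16 : ℂ)
  else 0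
/-- centred symbol -/
noncomputable def fsym (w : ℂ) : ℂ := (3 * Complex.cos (w / 2) - Complex.cos (w / 2) ^ 3) / 2

/-- majorant -/
noncomputable def Mj (θ τ : ℝ) : ℝ := Real.exp (-(1 / 1000) * θ ^ 4 + 20 * τ ^ 4)

noncomputable def Bsym (w : ℂ) : ℂ := Complex.exp (-(3 / 128) * w ^ 4)

lemma fsym_normSq (θ τ : ℝ) :
    ‖fsym (θ + τ * I)‖ ^ 2 = 1 + (-6 * (1 - Real.cos θ) ^ 2 - 6 * (Real.cosh τ - 1) ^ 2
      + 36 * (1 - Real.cos θ) * (Real.cosh τ - 1) + (Real.cosh τ - 1) ^ 3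
      + 9 * (1 - Real.cos θ) * (Real.cosh τ - 1) ^ 2
      - 9 * (1 - Real.cos θ) ^ 2 * (Real.cosh τ - 1) - (1 - Real.cos θ) ^ 3) / 32 := by
  have hc : Complex.cos ((θ + τ * I) / 2) =
      ⟨Real.cos (θ / 2) * Real.cosh (τ / 2), -(Real.sin (θ / 2) * Real.sinh (τ / 2))⟩ := by
    have : ((θ : ℂ) + τ * I) / 2 = ((θ / 2 : ℝ) : ℂ) + ((τ / 2 : ℝ) : ℂ) * I := by
      push_cast; ring
    rw [this, Complex.cos_add_mul_I, ← Complex.ofReal_cos, ← Complex.ofReal_cosh,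
      ← Complex.ofReal_sin, ← Complex.ofReal_sinh]
    generalize Real.cos (θ / 2) = a
    generalize Real.cosh (τ / 2) = b
    generalize Real.sin (θ / 2) = c
    generalize Real.sinh (τ / 2) = d
    apply Complex.ext <;> simp
  have h1 : Real.cos θ = 1 - 2 * Real.sin (θ / 2) ^ 2 := by
    have := Real.cos_two_mul (θ / 2)
    have h2 := Real.sin_sq_add_cos_sq (θ / 2)
    rw [show 2 * (θ / 2) = θ by ring] at this
    linarith
  have h2 : Real.cosh τ = 1 + 2 * Real.sinh (τ / 2) ^ 2 := by
    have := Real.cosh_two_mul (τ / 2)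
    have h2 := Real.cosh_sq (τ / 2)
    rw [show 2 * (τ / 2) = τ by ring] at this
    linarith
  have h3 := Real.cosh_sq (τ / 2)
  have h4 := Real.cos_sq' (θ / 2)
  rw [fsym, hc, ← Complex.normSq_eq_norm_sq, h1, h2]
  set a := Real.cos (θ / 2)
  set b := Real.sin (θ / 2)
  set p := Real.cosh (τ / 2)
  set q := Real.sinh (τ / 2)
  have e : (3 * (⟨a * p, -(b * q)⟩ : ℂ) - (⟨a * p, -(b * q)⟩ : ℂ) ^ 3) / 2
     = ((⟨a * p, -(b * q)⟩ : ℂ) * (⟨3 - (a ^ 2 * p ^ 2 - b ^ 2 * q ^ 2), 2 * a * b * p * q⟩ : ℂ)) / 2 := by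
    congr 1
    apply Complex.ext <;> simp [pow_succ] <;> ring
  rw [e, Complex.normSq_div, Complex.normSq_mul, Complex.normSq_mk, Complex.normSq_mk]
  have n2 : Complex.normSq 2 = 4 := by rw [Complex.normSq_ofNat]; norm_num
  rw [n2]
  have g1 : a * p * (a * p) + -(b * q) * -(b * q) = a ^ 2 * p ^ 2 + b ^ 2 * q ^ 2 := by ring
  have g2 : 2 * a * b * p * q * (2 * a * b * p * q) = 4 * a ^ 2 * p ^ 2 * (b ^ 2 * q ^ 2) := by ring
  rw [g1, g2, h3, h4]
  ring

lemma fsym_bound (θ τ : ℝ) (hθ : |θ| ≤ Real.pi) : ‖fsym (θ + τ * I)‖ ≤ Mj θ τ := by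
  have hM : (0:ℝ) ≤ Mj θ τ := (Real.exp_pos _).le
  refine le_of_sq_le_sq ?_ hM
  rw [fsym_normSq]
  have ht : 2 / Real.pi ^ 2 * θ ^ 2 ≤ 1 - Real.cos θ := by
    have := Real.cos_le_one_sub_mul_cos_sq hθ; linarith
  have ht2 : 1 - Real.cos θ ≤ 2 := by have := Real.neg_one_le_cos θ; linarith
  have ht0 : 0 ≤ 1 - Real.cos θ := by have := Real.cos_le_one θ; linarith
  have hs0 : 0 ≤ Real.cosh τ - 1 := by have := Real.one_le_cosh τ; linarith
  have hs : Real.cosh τ ≤ Real.exp (τ ^ 2 / 2) := Real.cosh_le_exp_half_sq τ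
  set t := 1 - Real.cos θ
  set s := Real.cosh τ - 1 with hsdef
  have hpi : Real.pi ^ 2 ≤ 10 := by nlinarith [Real.pi_lt_d2, Real.pi_pos]
  have ht' : θ ^ 2 / 5 ≤ t := by
    refine le_trans ?_ ht
    have : (1:ℝ) / 5 ≤ 2 / Real.pi ^ 2 := by
      rw [div_le_div_iff₀ (by norm_num) (by positivity)]; linarith
    nlinarith [sq_nonneg θ]
  have ht4 : θ ^ 4 / 25 ≤ t ^ 2 := by nlinarith [sq_nonneg θ]
  set b := (120 * s ^ 2 + s ^ 3) / 32 with hb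
  have hb0 : 0 ≤ b := by positivity
  have step1 : 1 + (-6 * t ^ 2 - 6 * s ^ 2 + 36 * t * s + s ^ 3 + 9 * t * s ^ 2
      - 9 * t ^ 2 * s - t ^ 3) / 32 ≤ 1 - 3 * t ^ 2 / 32 + b := by
    have e1 : 36 * t * s ≤ 3 * t ^ 2 + 108 * s ^ 2 := by nlinarith [sq_nonneg (t - 6 * s)]
    have e2 : 9 * t * s ^ 2 ≤ 18 * s ^ 2 := by nlinarith [sq_nonneg s]
    have e3 : 0 ≤ 9 * t ^ 2 * s := by positivity
    have e4 : 0 ≤ t ^ 3 := by positivity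
    rw [hb]; linarith
  have step2 : 1 + 2 * b ≤ Real.exp (40 * τ ^ 4) := by
    rcases le_or_gt |τ| 1 with h | h
    · have h2 : τ ^ 2 ≤ 1 := by rw [← sq_abs]; exact pow_le_one₀ (abs_nonneg _) h
      have e := Real.abs_exp_sub_one_le (x := τ ^ 2 / 2) (by rw [abs_of_nonneg (by positivity)]; linarith)
      rw [abs_of_nonneg (by positivity : 0 ≤ τ ^ 2 / 2)] at e
      have hs' : s ≤ τ ^ 2 := by
        have := le_abs_self (Real.exp (τ ^ 2 / 2) - 1)
        linarith
      have h4 : s ^ 2 ≤ τ ^ 4 := by nlinarith [sq_nonneg τ]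
      have h5 : s ^ 3 ≤ τ ^ 4 := by nlinarith [sq_nonneg s]
      have := Real.add_one_le_exp (40 * τ ^ 4)
      have : 0 ≤ τ ^ 4 := by positivity
      rw [hb]; linarith
    · have h2 : 1 ≤ τ ^ 2 := by rw [← sq_abs]; exact one_le_pow₀ h.le
      have h4 : τ ^ 2 ≤ τ ^ 4 := by nlinarith
      have hE : 1 ≤ Real.exp (τ ^ 2 / 2) := Real.one_le_exp (by positivity)
      have hs' : s ≤ Real.exp (τ ^ 2 / 2) := by linarith
      have hE3 : Real.exp (τ ^ 2 / 2) ^ 3 = Real.exp (3 / 2 * τ ^ 2) := by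
        rw [← Real.exp_nat_mul]; congr 1; push_cast; ring
      have h3 : s ^ 3 ≤ Real.exp (τ ^ 2 / 2) ^ 3 := pow_le_pow_left₀ hs0 hs' 3
      have h3' : s ^ 2 ≤ Real.exp (τ ^ 2 / 2) ^ 3 :=
        (pow_le_pow_left₀ hs0 hs' 2).trans (pow_le_pow_right₀ hE (by norm_num))
      have h1 : 1 ≤ Real.exp (τ ^ 2 / 2) ^ 3 := one_le_pow₀ hE
      rw [hE3] at h1 h3 h3'
      have h9 : (9 : ℝ) ≤ Real.exp 9 := by have := Real.add_one_le_exp (9:ℝ); linarith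
      calc 1 + 2 * b ≤ 9 * Real.exp (3 / 2 * τ ^ 2) := by rw [hb]; linarith
        _ ≤ Real.exp 9 * Real.exp (3 / 2 * τ ^ 2) := by gcongr
        _ = Real.exp (9 + 3 / 2 * τ ^ 2) := (Real.exp_add _ _).symm
        _ ≤ _ := Real.exp_le_exp.mpr (by linarith)
  have step3 : 1 - 3 * t ^ 2 / 32 ≤ Real.exp (-(3 * t ^ 2 / 32)) := by
    have := Real.add_one_le_exp (-(3 * t ^ 2 / 32)); linarith
  have step4 : 1 / 2 ≤ Real.exp (-(3 * t ^ 2 / 32)) := by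
    have : t ^ 2 ≤ 4 := by nlinarith
    linarith
  have hM2 : Mj θ τ ^ 2 = Real.exp (-(1 / 500) * θ ^ 4) * Real.exp (40 * τ ^ 4) := by
    rw [Mj, ← Real.exp_nat_mul, ← Real.exp_add]; congr 1; push_cast; ring
  rw [hM2]
  calc _ ≤ 1 - 3 * t ^ 2 / 32 + b := step1
    _ ≤ Real.exp (-(3 * t ^ 2 / 32)) * (1 + 2 * b) := by nlinarith
    _ ≤ _ := by
      gcongr
      have : 0 ≤ θ ^ 4 := by positivity
      linarith

lemma Bsym_bound (θ τ : ℝ) : ‖Bsym (θ + τ * I)‖ ≤ Mj θ τ := by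
  rw [Bsym, Complex.norm_exp, Mj]
  apply Real.exp_le_exp.mpr
  have : (-(3 / 128) * ((θ:ℂ) + τ * I) ^ 4).re = -(3 / 128) * (θ ^ 4 - 6 * θ ^ 2 * τ ^ 2 + τ ^ 4) := by
    have e : (-(3 / 128) * ((θ:ℂ) + τ * I) ^ 4) =
      ((-(3 / 128) * (θ ^ 4 - 6 * θ ^ 2 * τ ^ 2 + τ ^ 4) : ℝ) : ℂ)
        + ((-(3 / 128) * (4 * θ ^ 3 * τ - 4 * θ * τ ^ 3) : ℝ) : ℂ) * I := by
      push_cast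
      ring_nf
      simp only [show I ^ 3 = -I by rw [pow_succ, I_sq]; ring, I_sq, I_pow_four]
      ring
    rw [e, Complex.add_re, Complex.ofReal_re, Complex.re_ofReal_mul]; simp
  rw [this]
  nlinarith [sq_nonneg (θ ^ 2 - 6 * τ ^ 2), sq_nonneg (θ ^ 2), sq_nonneg (τ ^ 2)]

lemma normw_sq (θ τ : ℝ) : ‖(θ:ℂ) + τ * I‖ ^ 2 = θ ^ 2 + τ ^ 2 := by
  rw [← Complex.normSq_eq_norm_sq, Complex.normSq_add_mul_I]
lemma cos_taylor8 (z : ℂ) (hz : ‖z‖ ≤ 1) :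
    ‖Complex.cos z - (1 - z ^ 2 / 2 + z ^ 4 / 24 - z ^ 6 / 720)‖ ≤ ‖z‖ ^ 8 := by
  have n1 : ‖z * I‖ = ‖z‖ := by simp
  have n2 : ‖-z * I‖ = ‖z‖ := by simp
  have h1 := Complex.exp_bound (x := z * I) (by rw [n1]; exact hz) (n := 8) (by norm_num)
  have h2 := Complex.exp_bound (x := -z * I) (by rw [n2]; exact hz) (n := 8) (by norm_num)
  rw [n1] at h1
  rw [n2] at h2
  have e : Complex.cos z - (1 - z ^ 2 / 2 + z ^ 4 / 24 - z ^ 6 / 720) =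
      (1 / 2) * (Complex.exp (z * I) - ∑ m ∈ Finset.range 8, (z * I) ^ m / m.factorial)
      + (1 / 2) * (Complex.exp (-z * I) - ∑ m ∈ Finset.range 8, (-z * I) ^ m / m.factorial) := by
    rw [Complex.cos]
    simp only [Finset.sum_range_succ, Finset.sum_range_zero, Nat.factorial]
    push_cast
    ring_nf
    simp only [show I ^ 6 = -1 by rw [show (6:ℕ) = 4 + 2 by norm_num, pow_add, I_pow_four, I_sq]; ring,
      I_sq, I_pow_four]
    ring
  rw [e]
  refine (norm_add_le _ _).trans ?_
  rw [norm_mul, norm_mul]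
  have h8 : (0:ℝ) ≤ ‖z‖ ^ 8 := by positivity
  have hc : (((Nat.succ 8 : ℕ) : ℝ) * ((Nat.factorial 8 : ℕ) * (8 : ℕ) : ℝ)⁻¹) ≤ 1 := by
    norm_num [Nat.factorial]
  have hh : ‖(1 / 2 : ℂ)‖ = 1 / 2 := by norm_num
  rw [hh]
  have := mul_le_mul_of_nonneg_left hc h8
  linarith

lemma fsym_eq (w : ℂ) : fsym w = 9 / 8 * Complex.cos (w / 2) - 1 / 8 * Complex.cos (3 * (w / 2)) := by
  rw [Complex.cos_three_mul, fsym]; ring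

lemma local_est (w : ℂ) (hw : ‖w‖ ≤ 1 / 2) :
    ‖fsym w - Bsym w * (1 + w ^ 6 / 512)‖ ≤ 10 * ‖w‖ ^ 8 := by
  have na : ‖w / 2‖ = ‖w‖ / 2 := by simp
  have nb : ‖3 * (w / 2)‖ = 3 / 2 * ‖w‖ := by simp; ring
  have h1 := cos_taylor8 (w / 2) (by rw [na]; linarith)
  have h2 := cos_taylor8 (3 * (w / 2)) (by rw [nb]; linarith)
  rw [na] at h1
  rw [nb] at h2
  have nc : ‖-(3 / 128) * w ^ 4‖ = 3 / 128 * ‖w‖ ^ 4 := by simp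
  have hw0 := norm_nonneg w
  have h4 : ‖w‖ ^ 4 ≤ 1 := pow_le_one₀ hw0 (by linarith)
  have h6 : ‖w‖ ^ 6 ≤ 1 := pow_le_one₀ hw0 (by linarith)
  have h2' : ‖w‖ ^ 2 ≤ 1 := pow_le_one₀ hw0 (by linarith)
  have h3 := Complex.norm_exp_sub_one_sub_id_le (x := -(3 / 128) * w ^ 4) (by rw [nc]; linarith)
  rw [nc] at h3
  have e : fsym w - Bsym w * (1 + w ^ 6 / 512) =
      9 / 8 * (Complex.cos (w / 2) - (1 - (w / 2) ^ 2 / 2 + (w / 2) ^ 4 / 24 - (w / 2) ^ 6 / 720))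
      - 1 / 8 * (Complex.cos (3 * (w / 2)) - (1 - (3 * (w / 2)) ^ 2 / 2 + (3 * (w / 2)) ^ 4 / 24
        - (3 * (w / 2)) ^ 6 / 720))
      - (Complex.exp (-(3 / 128) * w ^ 4) - 1 - -(3 / 128) * w ^ 4) * (1 + w ^ 6 / 512)
      + 3 / 65536 * w ^ 10 := by
    rw [fsym_eq, Bsym]; ring
  rw [e]
  have h8 : (0:ℝ) ≤ ‖w‖ ^ 8 := by positivity
  have t1 : ‖(1 + w ^ 6 / 512 : ℂ)‖ ≤ 2 := by
    refine (norm_add_le _ _).trans ?_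
    simp only [norm_one, norm_div, norm_pow]
    norm_num
    linarith
  refine (norm_add_le _ _).trans ?_
  have t2 : ‖(3 / 65536 * w ^ 10 : ℂ)‖ ≤ ‖w‖ ^ 8 := by
    simp only [norm_mul, norm_div, norm_pow]
    norm_num
    have : ‖w‖ ^ 10 = ‖w‖ ^ 8 * ‖w‖ ^ 2 := by ring
    rw [this]
    nlinarith
  have t3 : ‖(Complex.exp (-(3 / 128) * w ^ 4) - 1 - -(3 / 128) * w ^ 4) * (1 + w ^ 6 / 512)‖
      ≤ ‖w‖ ^ 8 := by
    rw [norm_mul]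
    calc _ ≤ (3 / 128 * ‖w‖ ^ 4) ^ 2 * 2 := by gcongr
      _ ≤ _ := by nlinarith
  refine (add_le_add (norm_sub_le _ _) t2).trans ?_
  refine (add_le_add (add_le_add (norm_sub_le _ _) t3) le_rfl).trans ?_
  rw [norm_mul, norm_mul]
  have c1 : ‖(9 / 8 : ℂ)‖ = 9 / 8 := by norm_num
  have c2 : ‖(1 / 8 : ℂ)‖ = 1 / 8 := by norm_num
  rw [c1, c2]
  have g1 : (‖w‖ / 2) ^ 8 = 1 / 256 * ‖w‖ ^ 8 := by ring
  have g2 : (3 / 2 * ‖w‖) ^ 8 = 6561 / 256 * ‖w‖ ^ 8 := by ring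
  rw [g1] at h1
  rw [g2] at h2
  linarith

lemma Mj_pos (θ τ : ℝ) : 0 < Mj θ τ := Real.exp_pos _

lemma normw_four (θ τ : ℝ) : ‖(θ:ℂ) + τ * I‖ ^ 4 = (θ ^ 2 + τ ^ 2) ^ 2 := by
  rw [← normw_sq]; ring

lemma Mj_half (θ τ : ℝ) (hw : ‖(θ:ℂ) + τ * I‖ ≤ 1 / 2) : 1 / 2 ≤ Mj θ τ := by
  rw [Mj]
  have h := normw_four θ τ
  have : ‖(θ:ℂ) + τ * I‖ ^ 4 ≤ 1 := pow_le_one₀ (norm_nonneg _) (by linarith)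
  have h2 := Real.add_one_le_exp (-(1 / 1000) * θ ^ 4 + 20 * τ ^ 4)
  nlinarith [sq_nonneg (θ * τ), sq_nonneg (τ ^ 2), sq_nonneg (θ ^ 2)]

lemma K3 (θ τ : ℝ) (hθ : |θ| ≤ Real.pi) :
    ‖fsym (θ + τ * I) - Bsym (θ + τ * I) * (1 + (θ + τ * I) ^ 6 / 512)‖ ≤
      600 * ‖(θ:ℂ) + τ * I‖ ^ 8 * Mj θ τ := by
  have hM := Mj_pos θ τ
  have hA := fsym_bound θ τ hθ
  have hB := Bsym_bound θ τ
  rcases le_or_gt ‖(θ:ℂ) + τ * I‖ (1 / 2) with h | h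
  · have h1 := local_est _ h
    have h2 := Mj_half _ _ h
    have h8 : (0:ℝ) ≤ ‖(θ:ℂ) + τ * I‖ ^ 8 := by positivity
    nlinarith
  · set w := (θ:ℂ) + τ * I
    have h8 : (1/2) ^ 8 ≤ ‖w‖ ^ 8 := pow_le_pow_left₀ (by norm_num) h.le 8
    have h2 : (1/2) ^ 2 ≤ ‖w‖ ^ 2 := pow_le_pow_left₀ (by norm_num) h.le 2
    have h6 : ‖w‖ ^ 6 ≤ 4 * ‖w‖ ^ 8 := by
      have : ‖w‖ ^ 8 = ‖w‖ ^ 6 * ‖w‖ ^ 2 := by ring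
      have : 0 ≤ ‖w‖ ^ 6 := by positivity
      nlinarith
    have t1 : ‖(1 + w ^ 6 / 512 : ℂ)‖ ≤ 1 + ‖w‖ ^ 6 / 512 := by
      refine (norm_add_le _ _).trans ?_
      simp
    calc _ ≤ ‖fsym w‖ + ‖Bsym w * (1 + w ^ 6 / 512)‖ := norm_sub_le _ _
      _ ≤ Mj θ τ + Mj θ τ * (1 + ‖w‖ ^ 6 / 512) := by
        rw [norm_mul]; gcongr
      _ = (2 + ‖w‖ ^ 6 / 512) * Mj θ τ := by ring
      _ ≤ _ := by
        gcongr; linarith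

lemma K4 (θ τ : ℝ) (hθ : |θ| ≤ Real.pi) :
    ‖fsym (θ + τ * I) - Bsym (θ + τ * I)‖ ≤ 600 * ‖(θ:ℂ) + τ * I‖ ^ 6 * Mj θ τ := by
  have hM := Mj_pos θ τ
  have hA := fsym_bound θ τ hθ
  have hB := Bsym_bound θ τ
  rcases le_or_gt ‖(θ:ℂ) + τ * I‖ (1 / 2) with h | h
  · have h1 := local_est _ h
    have h2 := Mj_half _ _ h
    set w := (θ:ℂ) + τ * I
    have h6 : (0:ℝ) ≤ ‖w‖ ^ 6 := by positivity
    have h2' : ‖w‖ ^ 2 ≤ 1 := pow_le_one₀ (norm_nonneg _) (by linarith)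
    have h8 : ‖w‖ ^ 8 ≤ ‖w‖ ^ 6 := by
      have : ‖w‖ ^ 8 = ‖w‖ ^ 6 * ‖w‖ ^ 2 := by ring
      nlinarith
    have e : fsym w - Bsym w = (fsym w - Bsym w * (1 + w ^ 6 / 512)) + Bsym w * w ^ 6 / 512 := by ring
    have e2 : ‖Bsym w * w ^ 6 / 512‖ ≤ Mj θ τ * ‖w‖ ^ 6 := by
      rw [norm_div, norm_mul, norm_pow]
      have : ‖(512:ℂ)‖ = 512 := by norm_num
      rw [this]
      have : ‖Bsym w‖ * ‖w‖ ^ 6 ≤ Mj θ τ * ‖w‖ ^ 6 := by gcongr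
      have : 0 ≤ ‖Bsym w‖ * ‖w‖ ^ 6 := by positivity
      linarith
    rw [e]
    refine (norm_add_le _ _).trans ?_
    nlinarith
  · set w := (θ:ℂ) + τ * I
    have h6 : (1/2) ^ 6 ≤ ‖w‖ ^ 6 := pow_le_pow_left₀ (by norm_num) h.le 6
    have := norm_sub_le (fsym w) (Bsym w)
    nlinarith

lemma taylor2 (a b : ℂ) (ha : ‖a‖ ≤ 1) (hb : ‖b‖ ≤ 1) (n : ℕ) :
    ‖a ^ n - b ^ n - n * b ^ (n - 1) * (a - b)‖ ≤ (n:ℝ) ^ 2 * ‖a - b‖ ^ 2 := by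
  induction n with
  | zero => simp
  | succ n ih =>
    have e : a ^ (n + 1) - b ^ (n + 1) - ((n + 1 : ℕ) : ℂ) * b ^ (n + 1 - 1) * (a - b)
       = a * (a ^ n - b ^ n - n * b ^ (n - 1) * (a - b)) + n * b ^ (n - 1) * (a - b) ^ 2 := by
      rcases n with _ | n
      · simp
      · simp only [Nat.add_sub_cancel]; push_cast; ring
    rw [e]
    refine (norm_add_le _ _).trans ?_
    have h1 : ‖a * (a ^ n - b ^ n - n * b ^ (n - 1) * (a - b))‖ ≤ (n:ℝ) ^ 2 * ‖a - b‖ ^ 2 := by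
      rw [norm_mul]
      calc _ ≤ 1 * ‖(a ^ n - b ^ n - n * b ^ (n - 1) * (a - b))‖ := by gcongr
        _ ≤ _ := by rw [one_mul]; exact ih
    have h2 : ‖n * b ^ (n - 1) * (a - b) ^ 2‖ ≤ n * ‖a - b‖ ^ 2 := by
      rw [norm_mul, norm_mul, norm_pow, norm_pow, Complex.norm_natCast]
      have : ‖b‖ ^ (n - 1) ≤ 1 := pow_le_one₀ (norm_nonneg _) hb
      calc _ ≤ (n:ℝ) * 1 * ‖a - b‖ ^ 2 := by gcongr
        _ = _ := by ring
    refine (add_le_add h1 h2).trans ?_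
    push_cast
    have : 0 ≤ ‖a - b‖ ^ 2 := by positivity
    have : (0:ℝ) ≤ n := by positivity
    nlinarith

lemma E_inner (n : ℕ) (hn : 1 ≤ n) (θ τ : ℝ) (hθ : |θ| ≤ Real.pi) :
    ‖fsym (θ + τ * I) ^ n - Bsym (θ + τ * I) ^ n * (1 + n * (θ + τ * I) ^ 6 / 512)‖ ≤
     Mj θ τ ^ n * ((n:ℝ) ^ 2 * (600 * ‖(θ:ℂ) + τ * I‖ ^ 6) ^ 2 + n * (600 * ‖(θ:ℂ) + τ * I‖ ^ 8)) := by
  have hM := Mj_pos θ τ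
  have hA := fsym_bound θ τ hθ
  have hB := Bsym_bound θ τ
  have h3 := K3 θ τ hθ
  have h4 := K4 θ τ hθ
  set w := (θ:ℂ) + τ * I
  set M := Mj θ τ
  have hMc : (M:ℂ) ≠ 0 := by exact_mod_cast hM.ne'
  have nM : ‖(M:ℂ)‖ = M := by rw [Complex.norm_real, Real.norm_of_nonneg hM.le]
  obtain ⟨m, rfl⟩ : ∃ m, n = m + 1 := ⟨n - 1, by omega⟩
  set a := fsym w / M with ha
  set b := Bsym w / M with hb
  have na : ‖a‖ ≤ 1 := by rw [ha, norm_div, nM]; exact (div_le_one hM).mpr hA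
  have nb : ‖b‖ ≤ 1 := by rw [hb, norm_div, nM]; exact (div_le_one hM).mpr hB
  have fa : fsym w = M * a := by rw [ha]; field_simp
  have fb : Bsym w = M * b := by rw [hb]; field_simp
  have nab : ‖a - b‖ ≤ 600 * ‖w‖ ^ 6 := by
    rw [fa, fb, ← mul_sub, norm_mul, nM, mul_comm] at h4
    exact le_of_mul_le_mul_right h4 hM
  have nab3 : ‖a - b * (1 + w ^ 6 / 512)‖ ≤ 600 * ‖w‖ ^ 8 := by
    rw [fa, fb, mul_assoc, ← mul_sub, norm_mul, nM, mul_comm] at h3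
    exact le_of_mul_le_mul_right h3 hM
  have e : fsym w ^ (m + 1) - Bsym w ^ (m + 1) * (1 + ((m + 1 : ℕ) : ℂ) * w ^ 6 / 512) =
      M ^ (m + 1) * ((a ^ (m + 1) - b ^ (m + 1) - ((m + 1 : ℕ) : ℂ) * b ^ (m + 1 - 1) * (a - b))
        + ((m + 1 : ℕ) : ℂ) * (b ^ m * (a - b * (1 + w ^ 6 / 512)))) := by
    rw [fa, fb, Nat.add_sub_cancel]; push_cast; ring
  rw [e, norm_mul, norm_pow, nM]
  gcongr
  refine (norm_add_le _ _).trans ?_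
  refine add_le_add ((taylor2 a b na nb _).trans (by gcongr)) ?_
  rw [norm_mul, norm_mul, Complex.norm_natCast, norm_pow]
  have : ‖b‖ ^ m ≤ 1 := pow_le_one₀ (norm_nonneg _) nb
  refine mul_le_mul_of_nonneg_left ?_ (by positivity)
  calc _ ≤ 1 * ‖a - b * (1 + w ^ 6 / 512)‖ := by gcongr
    _ ≤ _ := by rw [one_mul]; exact nab3

lemma E_outer (n : ℕ) (θ τ : ℝ) (hθ : Real.pi ≤ |θ|) (hn : 1 ≤ n) :
    ‖Bsym (θ + τ * I) ^ n * (1 + n * (θ + τ * I) ^ 6 / 512)‖ ≤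
     Mj θ τ ^ n * ((n:ℝ) ^ 2 * (600 * ‖(θ:ℂ) + τ * I‖ ^ 6) ^ 2 + n * (600 * ‖(θ:ℂ) + τ * I‖ ^ 8)) := by
  have hM := Mj_pos θ τ
  have hB := Bsym_bound θ τ
  have h1 : 1 ≤ ‖(θ:ℂ) + τ * I‖ := by
    have := normw_sq θ τ
    have h2 : 1 ≤ |θ| := by linarith [Real.pi_gt_three]
    have h3 : 1 ≤ θ ^ 2 := by rw [← sq_abs]; exact one_le_pow₀ h2
    by_contra hc
    push Not at hc
    have : ‖(θ:ℂ) + τ * I‖ ^ 2 < 1 := pow_lt_one₀ (norm_nonneg _) hc (by norm_num)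
    nlinarith
  set w := (θ:ℂ) + τ * I
  rw [norm_mul, norm_pow]
  have t1 : ‖(1 + n * w ^ 6 / 512 : ℂ)‖ ≤ 1 + n * ‖w‖ ^ 6 := by
    refine (norm_add_le _ _).trans ?_
    rw [norm_div, norm_mul, norm_pow, Complex.norm_natCast]
    have : ‖(512:ℂ)‖ = 512 := by norm_num
    rw [this, norm_one]
    have : 0 ≤ n * ‖w‖ ^ 6 := by positivity
    linarith
  have h8 : 1 ≤ ‖w‖ ^ 8 := one_le_pow₀ h1
  have h6 : ‖w‖ ^ 6 ≤ ‖w‖ ^ 8 := pow_le_pow_right₀ h1 (by norm_num)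
  have hn' : (1:ℝ) ≤ n := by exact_mod_cast hn
  gcongr
  refine t1.trans ?_
  have : 0 ≤ (n:ℝ) ^ 2 * (600 * ‖w‖ ^ 6) ^ 2 := by positivity
  have : n * ‖w‖ ^ 6 ≤ n * ‖w‖ ^ 8 := by gcongr
  nlinarith

noncomputable def Kc : ℝ := 360000 * (6 * 4000 ^ 3) + 600 * (2 * 4000 ^ 2)

lemma absorb (n : ℕ) (hn : 1 ≤ n) (θ τ : ℝ) :
    Mj θ τ ^ n * ((n:ℝ) ^ 2 * (600 * ‖(θ:ℂ) + τ * I‖ ^ 6) ^ 2 + n * (600 * ‖(θ:ℂ) + τ * I‖ ^ 8)) ≤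
    Kc * (n:ℝ)⁻¹ * Real.exp (-(1 / 2000) * (n * θ ^ 4)) * Real.exp (21 * (n * τ ^ 4)) := by
  have hn' : (0:ℝ) < n := by exact_mod_cast hn
  have hw := normw_four θ τ
  set r := ‖(θ:ℂ) + τ * I‖
  set Y : ℝ := n * r ^ 4 with hY
  have hY0 : 0 ≤ Y := by positivity
  have hx0 : 0 ≤ Y / 4000 := by positivity
  have p2 := Real.pow_div_factorial_le_exp (Y / 4000) hx0 2
  have p3 := Real.pow_div_factorial_le_exp (Y / 4000) hx0 3
  norm_num [Nat.factorial] at p2 p3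
  have e : (n:ℝ) ^ 2 * (600 * r ^ 6) ^ 2 + n * (600 * r ^ 8) =
     (n:ℝ)⁻¹ * (360000 * Y ^ 3 + 600 * Y ^ 2) := by
    rw [hY]; field_simp; ring
  have b : 360000 * Y ^ 3 + 600 * Y ^ 2 ≤ Kc * Real.exp (Y / 4000) := by
    rw [Kc]; nlinarith
  have hexp : Mj θ τ ^ n * Real.exp (Y / 4000) ≤
      Real.exp (-(1 / 2000) * (n * θ ^ 4)) * Real.exp (21 * (n * τ ^ 4)) := by
    rw [Mj, ← Real.exp_nat_mul, ← Real.exp_add, ← Real.exp_add]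
    apply Real.exp_le_exp.mpr
    have : r ^ 4 ≤ 2 * (θ ^ 4 + τ ^ 4) := by rw [hw]; nlinarith [sq_nonneg (θ ^ 2 - τ ^ 2)]
    have h2 : Y ≤ n * (2 * (θ ^ 4 + τ ^ 4)) := by rw [hY]; gcongr
    have h3 : 0 ≤ n * τ ^ 4 := by positivity
    nlinarith
  have hK : 0 ≤ Kc := by rw [Kc]; norm_num
  have hM := (pow_pos (Mj_pos θ τ) n).le
  calc _ = Mj θ τ ^ n * ((n:ℝ)⁻¹ * (360000 * Y ^ 3 + 600 * Y ^ 2)) := by rw [e]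
    _ ≤ Mj θ τ ^ n * ((n:ℝ)⁻¹ * (Kc * Real.exp (Y / 4000))) := by gcongr
    _ = Kc * (n:ℝ)⁻¹ * (Mj θ τ ^ n * Real.exp (Y / 4000)) := by ring
    _ ≤ Kc * (n:ℝ)⁻¹ * (Real.exp (-(1 / 2000) * (n * θ ^ 4)) * Real.exp (21 * (n * τ ^ 4))) := by
      gcongr
    _ = _ := by ring
noncomputable def Fsym (w : ℂ) : ℂ :=
  -1 / 16 * Complex.exp (-I * w) + 9 / 16 + 9 / 16 * Complex.exp (I * w)
    + -1 / 16 * Complex.exp (2 * I * w)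

lemma orth (m : ℤ) (τ : ℝ) :
    ∫ θ in (-Real.pi)..Real.pi, Complex.exp (-I * m * (θ + τ * I)) =
      if m = 0 then 2 * (Real.pi : ℂ) else 0 := by
  split_ifs with h
  · subst h
    simp
    ring
  · have hc : (-I * m : ℂ) ≠ 0 := by
      simp [h]
    have e : ∀ θ : ℝ, Complex.exp (-I * m * (θ + τ * I)) =
        Complex.exp (m * τ) * Complex.exp (-I * m * θ) := by
      intro θ
      rw [← Complex.exp_add]; congr 1
      linear_combination (-(m:ℂ) * τ) * I_mul_I
    simp_rw [e]
    rw [intervalIntegral.integral_const_mul, integral_exp_mul_complex hc]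
    have : Complex.exp (-I * m * (Real.pi : ℝ)) = Complex.exp (-I * m * ((-Real.pi : ℝ) : ℂ)) := by
      rw [Complex.exp_eq_exp_iff_exists_int]
      exact ⟨-m, by push_cast; ring⟩
    rw [this]; simp

lemma conv_O3 (u : ℤ → ℂ) (ℓ : ℤ) : conv u O3half ℓ =
    -1 / 16 * u (ℓ + 1) + 9 / 16 * u ℓ + 9 / 16 * u (ℓ - 1) + -1 / 16 * u (ℓ - 2) := by
  rw [conv, tsum_eq_sum (s := {-1, 0, 1, 2})]
  · simp [O3half]; ring
  · intro b hb
    simp only [Finset.mem_insert, Finset.mem_singleton, not_or] at hb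
    simp [O3half, hb]

noncomputable def Jint (τ : ℝ) (n : ℕ) (ℓ : ℤ) : ℂ :=
  ∫ θ in (-Real.pi)..Real.pi, Complex.exp (-I * ℓ * (θ + τ * I)) * Fsym (θ + τ * I) ^ n

lemma Jint_succ (τ : ℝ) (n : ℕ) (ℓ : ℤ) : Jint τ (n + 1) ℓ =
    -1 / 16 * Jint τ n (ℓ + 1) + 9 / 16 * Jint τ n ℓ + 9 / 16 * Jint τ n (ℓ - 1)
      + -1 / 16 * Jint τ n (ℓ - 2) := by
  unfold Jint
  have hi : ∀ k : ℤ, IntervalIntegrable (fun θ : ℝ => Complex.exp (-I * k * (θ + τ * I)) *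
      Fsym (θ + τ * I) ^ n) MeasureTheory.volume (-Real.pi) Real.pi := by
    intro k
    apply Continuous.intervalIntegrable
    unfold Fsym
    fun_prop
  simp only [← intervalIntegral.integral_const_mul]
  rw [← intervalIntegral.integral_add ((hi _).const_mul _) ((hi _).const_mul _),
    ← intervalIntegral.integral_add (((hi _).const_mul _).add ((hi _).const_mul _)) ((hi _).const_mul _),
    ← intervalIntegral.integral_add ((((hi _).const_mul _).add ((hi _).const_mul _)).add ((hi _).const_mul _)) ((hi _).const_mul _)]
  congr 1
  ext θ
  set w := (θ:ℂ) + τ * I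
  have e1 : Complex.exp (-I * ((ℓ + 1 : ℤ) : ℂ) * w) = Complex.exp (-I * ℓ * w) * Complex.exp (-I * w) := by
    rw [← Complex.exp_add]; congr 1; push_cast; ring
  have e2 : Complex.exp (-I * ((ℓ - 1 : ℤ) : ℂ) * w) = Complex.exp (-I * ℓ * w) * Complex.exp (I * w) := by
    rw [← Complex.exp_add]; congr 1; push_cast; ring
  have e3 : Complex.exp (-I * ((ℓ - 2 : ℤ) : ℂ) * w) = Complex.exp (-I * ℓ * w) * Complex.exp (2 * I * w) := by
    rw [← Complex.exp_add]; congr 1; push_cast; ring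
  rw [e1, e2, e3, pow_succ]
  nth_rewrite 2 [Fsym]
  ring

lemma iter_eq (τ : ℝ) (m : ℕ) (ℓ : ℤ) : Jint τ (m + 1) ℓ = 2 * Real.pi * iterConv O3half m ℓ := by
  induction m generalizing ℓ with
  | zero =>
    have h0 : ∀ k, Jint τ 0 k = if k = 0 then 2 * (Real.pi : ℂ) else 0 := by
      intro k; rw [← orth k τ, Jint]; simp
    rw [Jint_succ]
    simp only [h0, iterConv, O3half]
    by_cases h1 : ℓ = -1
    · subst h1; norm_num; ring
    by_cases h2 : ℓ = 0
    · subst h2; norm_num; ring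
    by_cases h3 : ℓ = 1
    · subst h3; norm_num; ring
    by_cases h4 : ℓ = 2
    · subst h4; norm_num; ring
    rw [if_neg (by omega), if_neg (by omega), if_neg (by omega), if_neg (by omega),
      if_neg (by omega), if_neg (by omega), if_neg (by omega), if_neg (by omega)]
    ring
  | succ m ih =>
    rw [Jint_succ, ih, ih, ih, ih, iterConv, conv_O3]
    ring

lemma Fsym_eq (w : ℂ) : Fsym w = Complex.exp (I * w / 2) * fsym w := by
  rw [fsym_eq, Complex.cos, Complex.cos, Fsym]
  have h1 : Complex.exp (w / 2 * I) = Complex.exp (I * w / 2) := by congr 1; ring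
  have h2 : Complex.exp (-(w / 2) * I) = Complex.exp (-(I * w / 2)) := by congr 1; ring
  have h3 : Complex.exp (3 * (w / 2) * I) = Complex.exp (I * w / 2) ^ 3 := by
    rw [← Complex.exp_nat_mul]; congr 1; push_cast; ring
  have h4 : Complex.exp (-(3 * (w / 2)) * I) = Complex.exp (-(I * w / 2)) ^ 3 := by
    rw [← Complex.exp_nat_mul]; congr 1; push_cast; ring
  have h5 : Complex.exp (-I * w) = Complex.exp (-(I * w / 2)) ^ 2 := by
    rw [← Complex.exp_nat_mul]; congr 1; push_cast; ring
  have h6 : Complex.exp (I * w) = Complex.exp (I * w / 2) ^ 2 := by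
    rw [← Complex.exp_nat_mul]; congr 1; push_cast; ring
  have h7 : Complex.exp (2 * I * w) = Complex.exp (I * w / 2) ^ 4 := by
    rw [← Complex.exp_nat_mul]; congr 1; push_cast; ring
  have h8 : Complex.exp (I * w / 2) * Complex.exp (-(I * w / 2)) = 1 := by
    rw [← Complex.exp_add]; simp
  rw [h1, h2, h3, h4, h5, h6, h7]
  set p := Complex.exp (I * w / 2)
  set q := Complex.exp (-(I * w / 2))
  linear_combination (-9 / 16 + 1 / 16 * q ^ 2) * h8

lemma iter_formula (τ : ℝ) (n : ℕ) (hn : 1 ≤ n) (ℓ : ℤ) :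
    ∫ θ in (-Real.pi)..Real.pi, Complex.exp (-I * (((ℓ : ℝ) - n / 2 : ℝ) : ℂ) * (θ + τ * I))
      * fsym (θ + τ * I) ^ n = 2 * Real.pi * iterConv O3half (n - 1) ℓ := by
  rw [← iter_eq τ, Nat.sub_add_cancel hn, Jint]
  congr 1
  ext θ
  rw [Fsym_eq, mul_pow, ← mul_assoc, ← Complex.exp_nat_mul, ← Complex.exp_add]
  congr 2
  push_cast
  ring

open MeasureTheory Filter Topology in
lemma shift_contour (G : ℂ → ℂ) (hG : Differentiable ℂ G) (τ : ℝ) (g : ℝ → ℝ)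
    (hg : Integrable g) (hg0 : Tendsto g atTop (𝓝 0)) (hge : ∀ x, g (-x) = g x)
    (hb : ∀ θ y : ℝ, |y| ≤ |τ| → ‖G (θ + y * I)‖ ≤ g θ) :
    ∫ θ : ℝ, G (θ + τ * I) = ∫ θ : ℝ, G θ := by
  have hcont := hG.continuous
  have i1 : Integrable (fun θ : ℝ => G (θ + τ * I)) :=
    hg.mono' (by apply Continuous.aestronglyMeasurable; fun_prop)
      (Eventually.of_forall fun θ => hb θ τ le_rfl)
  have i0 : Integrable (fun θ : ℝ => G θ) :=
    hg.mono' (by apply Continuous.aestronglyMeasurable; fun_prop)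
      (Eventually.of_forall fun θ => by simpa using hb θ 0 (by simp))
  have t1 := intervalIntegral_tendsto_integral i1 tendsto_neg_atTop_atBot tendsto_id
  have t0 := intervalIntegral_tendsto_integral i0 tendsto_neg_atTop_atBot tendsto_id
  have hd := t0.sub t1
  have hv : ∀ R : ℝ, ‖(∫ x in (-R)..R, G x) - ∫ x in (-R)..R, G (x + τ * I)‖ ≤ 2 * (g R * |τ|) := by
    intro R
    have h := Complex.integral_boundary_rect_eq_zero_of_differentiableOn G ((-R : ℝ) : ℂ)
      ((R : ℂ) + τ * I) hG.differentiableOn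
    simp only [Complex.ofReal_re, Complex.ofReal_im, Complex.add_re, Complex.add_im,
      Complex.mul_re, Complex.mul_im, Complex.I_re, Complex.I_im, mul_zero, mul_one, sub_zero,
      add_zero, zero_add, Complex.ofReal_zero, zero_mul] at h
    have bnd : ∀ r : ℝ, ‖∫ y in (0:ℝ)..τ, G (r + y * I)‖ ≤ g r * |τ| := by
      intro r
      have := intervalIntegral.norm_integral_le_of_norm_le_const (a := 0) (b := τ) (C := g r)
        (f := fun y : ℝ => G (r + y * I)) (fun y hy => hb r y (by
          simpa using Set.abs_sub_left_of_mem_uIcc (Set.uIoc_subset_uIcc hy)))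
      simpa using this
    have b1 := bnd R
    have b2 := bnd (-R)
    rw [hge] at b2
    have e : (∫ x in (-R)..R, G x) - ∫ x in (-R)..R, G (x + τ * I) =
      I • (∫ y in (0:ℝ)..τ, G (((-R : ℝ) : ℂ) + y * I)) - I • ∫ y in (0:ℝ)..τ, G (R + y * I) := by
      linear_combination h
    rw [e]
    refine (norm_sub_le _ _).trans ?_
    rw [norm_smul, norm_smul, norm_I]
    linarith
  have hz : Tendsto (fun R : ℝ => (∫ x in (-R)..R, G x) - ∫ x in (-R)..R, G (x + τ * I)) atTop (𝓝 0) := by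
    apply squeeze_zero_norm hv
    simpa using (hg0.mul_const |τ|).const_mul 2
  have := tendsto_nhds_unique hd hz
  exact (sub_eq_zero.mp this).symm
open MeasureTheory in
lemma integrable_pow_exp4 (k : ℕ) (b : ℝ) (hb : 0 < b) :
    Integrable (fun v : ℝ => v ^ k * Real.exp (-b * v ^ 4)) := by
  have h := integrable_rpow_mul_exp_neg_mul_sq hb (s := k)
    (by have : (0:ℝ) ≤ k := by positivity
        linarith)
  simp only [Real.rpow_natCast] at h
  refine (h.norm.const_mul (Real.exp b)).mono'
    (by apply Continuous.aestronglyMeasurable; fun_prop) (Filter.Eventually.of_forall fun v => ?_)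
  rw [norm_mul, norm_mul, Real.norm_of_nonneg (Real.exp_pos _).le,
    Real.norm_of_nonneg (Real.exp_pos _).le]
  have : Real.exp (-b * v ^ 4) ≤ Real.exp b * Real.exp (-b * v ^ 2) := by
    rw [← Real.exp_add]
    apply Real.exp_le_exp.mpr
    nlinarith [mul_nonneg hb.le (sq_nonneg (v ^ 2 - 1)), mul_nonneg hb.le (sq_nonneg v)]
  calc _ ≤ ‖v ^ k‖ * (Real.exp b * Real.exp (-b * v ^ 2)) := by gcongr
    _ = _ := by ring

/-- the Fourier-side integrals -/
noncomputable def Hk (k : ℕ) (x : ℝ) : ℂ :=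
  ∫ θ : ℝ, (θ : ℂ) ^ k * (Complex.exp (-I * x * θ) * Complex.exp (-(3 / 128) * (θ : ℂ) ^ 4))

lemma Hfun_eq (x : ℝ) : Hfun 2 (3 / 128) x = 1 / (2 * Real.pi : ℂ) * Hk 0 x := by
  rw [Hfun, Hk]; simp

open MeasureTheory FourierTransform in
lemma Hfun_iter (x : ℝ) :
    iteratedDeriv 6 (Hfun 2 (3 / 128)) x = -(1 / (2 * Real.pi : ℂ) * Hk 6 x) := by
  have hpi := Real.pi_pos
  have hpic : (Real.pi : ℂ) ≠ 0 := by exact_mod_cast hpi.ne'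
  set f : ℝ → ℂ := fun v => Complex.exp (-(3 / 128) * ((2 * Real.pi * v : ℝ) : ℂ) ^ 4) with hf
  have key : ∀ (k : ℕ) (y : ℝ), 𝓕 (fun v : ℝ => ((2 * Real.pi * v : ℝ) : ℂ) ^ k * f v) y
      = 1 / (2 * Real.pi : ℂ) * Hk k y := by
    intro k y
    rw [Real.fourier_real_eq_integral_exp_smul, Hk]
    have := Measure.integral_comp_mul_left (fun θ : ℝ => (θ : ℂ) ^ k * (Complex.exp (-I * y * θ) *
      Complex.exp (-(3 / 128) * (θ : ℂ) ^ 4))) (2 * Real.pi)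
    rw [abs_of_pos (by positivity), Complex.real_smul] at this
    push_cast at this
    rw [one_div, ← this]
    congr 1
    ext v
    rw [smul_eq_mul, hf]
    have : Complex.exp (((-2 * Real.pi * v * y : ℝ) : ℂ) * I) =
      Complex.exp (-I * y * (2 * Real.pi * v)) := by
      congr 1; push_cast; ring
    rw [this]
    push_cast
    ring
  have hH : Hfun 2 (3 / 128) = 𝓕 f := by
    ext y
    rw [Hfun_eq, ← key 0 y]
    simp
  have hint : ∀ k : ℕ, Integrable (fun v : ℝ => v ^ k • f v) := by
    intro k
    have h := integrable_pow_exp4 k (3 / 128 * (2 * Real.pi) ^ 4) (by positivity)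
    refine h.norm.mono' (by apply Continuous.aestronglyMeasurable; rw [hf]; fun_prop)
      (Filter.Eventually.of_forall fun v => ?_)
    rw [norm_smul, norm_mul, Real.norm_of_nonneg (Real.exp_pos _).le, hf, Complex.norm_exp]
    apply le_of_eq
    congr 2
    have : (-(3 / 128) * ((2 * Real.pi * v : ℝ) : ℂ) ^ 4) =
      ((-(3 / 128 * (2 * Real.pi) ^ 4) * v ^ 4 : ℝ) : ℂ) := by push_cast; ring
    rw [this, Complex.ofReal_re]
  rw [hH, Real.iteratedDeriv_fourier (N := ⊤) (fun k _ => hint k) le_top, ← key 6 x]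
  have : (fun v : ℝ => (-2 * Real.pi * I * v) ^ 6 • f v) =
      (-1 : ℂ) • (fun v : ℝ => ((2 * Real.pi * v : ℝ) : ℂ) ^ 6 * f v) := by
    ext v
    simp only [Pi.smul_apply, smul_eq_mul]
    have i6 : I ^ 6 = -1 := by
      rw [show (6:ℕ) = 4 + 2 by norm_num, pow_add, I_pow_four, I_sq]; ring
    push_cast
    linear_combination (64 * (Real.pi : ℂ) ^ 6 * v ^ 6 * f v) * i6
  rw [this, Real.fourier_real_eq_integral_exp_smul, Real.fourier_real_eq_integral_exp_smul,
    ← integral_neg]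
  congr 1
  ext v
  simp only [Pi.smul_apply, smul_eq_mul]
  ring

noncomputable def Gs (n : ℕ) (x : ℝ) (w : ℂ) : ℂ :=
  Complex.exp (-I * x * w) * (Bsym w ^ n * (1 + n * w ^ 6 / 512))

open MeasureTheory in
lemma Gs_integral (n : ℕ) (hn : 1 ≤ n) (x : ℝ) :
    ∫ θ : ℝ, Gs n x θ = 2 * Real.pi *
      (((n : ℝ) ^ (-(1 : ℝ) / 4) : ℝ) * Hfun 2 (3 / 128) (x / (n : ℝ) ^ ((1 : ℝ) / 4)) -
       ((1 / (512 * (n : ℝ) ^ ((3 : ℝ) / 4)) : ℝ)) *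
              iteratedDeriv 6 (Hfun 2 (3 / 128)) (x / (n : ℝ) ^ ((1 : ℝ) / 4))) := by
  have hn0 : (0:ℝ) < n := by exact_mod_cast hn
  have hpic : (Real.pi : ℂ) ≠ 0 := by exact_mod_cast Real.pi_pos.ne'
  set N : ℝ := (n : ℝ) ^ ((1 : ℝ) / 4) with hN
  have hN0 : 0 < N := by positivity
  have hN4 : N ^ 4 = n := by
    rw [hN, ← Real.rpow_natCast, ← Real.rpow_mul hn0.le]; norm_num
  have hNm : (n : ℝ) ^ (-(1 : ℝ) / 4) = N⁻¹ := by
    rw [hN, ← Real.rpow_neg hn0.le]; norm_num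
  have hN3 : (n : ℝ) ^ ((3 : ℝ) / 4) = N ^ 3 := by
    rw [hN, ← Real.rpow_natCast, ← Real.rpow_mul hn0.le]; norm_num
  have hN4c : (N:ℂ) ^ 4 = n := by exact_mod_cast hN4
  have hN0c : (N:ℂ) ≠ 0 := by exact_mod_cast hN0.ne'
  rw [hNm, hN3, Hfun_iter, Hfun_eq]
  set y := x / N with hy
  have hxy : (x:ℂ) = y * N := by rw [hy]; push_cast; field_simp
  set P : ℕ → ℝ → ℂ := fun k θ => (θ : ℂ) ^ k * (Complex.exp (-I * y * θ) *
      Complex.exp (-(3 / 128) * (θ : ℂ) ^ 4)) with hP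
  have hint : ∀ k : ℕ, Integrable (P k) := by
    intro k
    have h := integrable_pow_exp4 k (3 / 128) (by positivity)
    refine h.norm.mono' (by apply Continuous.aestronglyMeasurable; rw [hP]; fun_prop)
      (Filter.Eventually.of_forall fun v => ?_)
    rw [hP]
    simp only
    rw [norm_mul, norm_mul, norm_mul, Real.norm_of_nonneg (Real.exp_pos _).le, Complex.norm_exp, Complex.norm_exp]
    have e1 : (-(3 / 128) * (v : ℂ) ^ 4) =
      ((-(3 / 128) * v ^ 4 : ℝ) : ℂ) := by push_cast; ring
    have e2 : (-I * y * v).re = 0 := by simp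
    rw [e1, e2, Complex.ofReal_re]
    simp
  have e : ∀ θ : ℝ, Gs n x θ = P 0 (N * θ) + 1 / (512 * N ^ 2) * P 6 (N * θ) := by
    intro θ
    rw [hP, Gs, Bsym, ← Complex.exp_nat_mul, hxy, ← hN4c]
    have e1 : Complex.exp ((N:ℂ) ^ 4 * (-(3 / 128) * (θ:ℂ) ^ 4)) =
      Complex.exp (-(3 / 128) * ((N * θ : ℝ) : ℂ) ^ 4) := by congr 1; push_cast; ring
    have e2 : Complex.exp (-I * (y * N) * θ) =
      Complex.exp (-I * y * ((N * θ : ℝ) : ℂ)) := by congr 1; push_cast; ring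
    simp only
    rw [e1, e2]
    push_cast
    field_simp
  simp_rw [e]
  rw [Measure.integral_comp_mul_left (fun θ => P 0 θ + 1 / (512 * N ^ 2) * P 6 θ) N,
    integral_add (hint 0) ((hint 6).const_mul _), integral_const_mul]
  have h0 : ∫ θ, P 0 θ = Hk 0 y := rfl
  have h6 : ∫ θ, P 6 θ = Hk 6 y := rfl
  rw [h0, h6, abs_of_pos (by positivity), Complex.real_smul]
  push_cast
  field_simp
  ring

lemma Mj_pow_le (n : ℕ) (θ τ : ℝ) : Mj θ τ ^ n ≤
    Real.exp (-(1 / 2000) * (n * θ ^ 4)) * Real.exp (21 * (n * τ ^ 4)) := by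
  rw [Mj, ← Real.exp_nat_mul, ← Real.exp_add]
  apply Real.exp_le_exp.mpr
  have h1 : 0 ≤ n * τ ^ 4 := by positivity
  have h2 : 0 ≤ n * θ ^ 4 := by positivity
  linarith

lemma norm_exp_x (x θ τ : ℝ) : ‖Complex.exp (-I * x * (θ + τ * I))‖ = Real.exp (x * τ) := by
  rw [Complex.norm_exp]; congr 1; simp

lemma Gs_strip (n : ℕ) (hn : 1 ≤ n) (x τ : ℝ) : ∃ K : ℝ, ∀ θ y : ℝ, |y| ≤ |τ| →
    ‖Gs n x (θ + y * I)‖ ≤ K * Real.exp (-(n / 2000) * θ ^ 4) := by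
  refine ⟨Real.exp (|x| * |τ|) * ((1 + n + Kc * (n:ℝ)⁻¹) * Real.exp (21 * (n * τ ^ 4))), ?_⟩
  intro θ y hy
  have ha := absorb n hn θ y
  have hb := Bsym_bound θ y
  have hm := Mj_pow_le n θ y
  have hM := Mj_pos θ y
  rw [Gs, norm_mul, norm_exp_x, norm_mul, norm_pow]
  set w := (θ:ℂ) + y * I
  have t1 : ‖(1 + n * w ^ 6 / 512 : ℂ)‖ ≤
      (1 + n) + ((n:ℝ) ^ 2 * (600 * ‖w‖ ^ 6) ^ 2 + n * (600 * ‖w‖ ^ 8)) := by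
    refine (norm_add_le _ _).trans ?_
    rw [norm_div, norm_mul, norm_pow, Complex.norm_natCast]
    have : ‖(512:ℂ)‖ = 512 := by norm_num
    rw [this, norm_one]
    have h1 : 0 ≤ n * ‖w‖ ^ 6 := by positivity
    have h2 : ‖w‖ ^ 6 ≤ 1 + ‖w‖ ^ 8 := by
      rcases le_or_gt ‖w‖ 1 with h | h
      · have := pow_le_one₀ (norm_nonneg w) h (n := 6)
        have : 0 ≤ ‖w‖ ^ 8 := by positivity
        linarith
      · have : ‖w‖ ^ 6 ≤ ‖w‖ ^ 8 := pow_le_pow_right₀ h.le (by norm_num)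
        linarith
    have h3 : n * ‖w‖ ^ 6 ≤ n * (1 + ‖w‖ ^ 8) := by gcongr
    have h4 : 0 ≤ (n:ℝ) ^ 2 * (600 * ‖w‖ ^ 6) ^ 2 := by positivity
    have h5 : 0 ≤ n * ‖w‖ ^ 8 := by positivity
    linarith
  have hK : 0 ≤ Kc := by rw [Kc]; norm_num
  have hy4 : y ^ 4 ≤ τ ^ 4 := by
    have := pow_le_pow_left₀ (abs_nonneg y) hy 4
    rwa [(by decide : Even 4).pow_abs, (by decide : Even 4).pow_abs] at this
  have hx : x * y ≤ |x| * |τ| := by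
    calc x * y ≤ |x * y| := le_abs_self _
      _ = |x| * |y| := abs_mul _ _
      _ ≤ _ := by gcongr
  rw [mul_assoc]
  refine mul_le_mul (Real.exp_le_exp.mpr hx) ?_ (by positivity) (by positivity)
  calc ‖Bsym w‖ ^ n * ‖(1 + n * w ^ 6 / 512 : ℂ)‖
      ≤ Mj θ y ^ n * ((1 + n) + ((n:ℝ) ^ 2 * (600 * ‖w‖ ^ 6) ^ 2 + n * (600 * ‖w‖ ^ 8))) := by
        gcongr
    _ = (1 + n) * Mj θ y ^ n + Mj θ y ^ n * ((n:ℝ) ^ 2 * (600 * ‖w‖ ^ 6) ^ 2 + n * (600 * ‖w‖ ^ 8)) := by ring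
    _ ≤ (1 + n) * (Real.exp (-(1 / 2000) * (n * θ ^ 4)) * Real.exp (21 * (n * y ^ 4))) +
       Kc * (n:ℝ)⁻¹ * Real.exp (-(1 / 2000) * (n * θ ^ 4)) * Real.exp (21 * (n * y ^ 4)) := by
        gcongr
    _ = (1 + n + Kc * (n:ℝ)⁻¹) * Real.exp (21 * (n * y ^ 4)) * Real.exp (-(n / 2000) * θ ^ 4) := by
        rw [show -(1 / 2000) * (n * θ ^ 4) = -(n / 2000) * θ ^ 4 by ring]; ring
    _ ≤ _ := by gcongr

open MeasureTheory Filter Topology in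
lemma Gs_shift (n : ℕ) (hn : 1 ≤ n) (x τ : ℝ) :
    Integrable (fun θ : ℝ => Gs n x (θ + τ * I)) ∧
    ∫ θ : ℝ, Gs n x (θ + τ * I) = ∫ θ : ℝ, Gs n x θ := by
  obtain ⟨K, hK⟩ := Gs_strip n hn x τ
  have hn0 : (0:ℝ) < n := by exact_mod_cast hn
  have hg : Integrable (fun θ : ℝ => K * Real.exp (-(n / 2000) * θ ^ 4)) := by
    have := (integrable_pow_exp4 0 (n / 2000) (by positivity)).const_mul K
    simpa using this
  have hd : Differentiable ℂ (Gs n x) := by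
    unfold Gs Bsym; fun_prop
  have hc := hd.continuous
  refine ⟨hg.mono' (by apply Continuous.aestronglyMeasurable; fun_prop)
      (Eventually.of_forall fun θ => hK θ τ le_rfl), ?_⟩
  refine shift_contour _ hd τ _ hg ?_ ?_ hK
  · rw [show (0:ℝ) = K * 0 by ring]
    refine Tendsto.const_mul _ ?_
    refine Real.tendsto_exp_atBot.comp ?_
    refine Tendsto.const_mul_atTop_of_neg (by linarith [show (0:ℝ) < n / 2000 by positivity]) ?_
    exact tendsto_pow_atTop (by norm_num)
  · intro θ; congr 3; ring

open MeasureTheory in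
lemma main_bound (n : ℕ) (hn : 1 ≤ n) (ℓ : ℤ) (x τ : ℝ) (hx : x = (ℓ : ℝ) - n / 2) :
    ‖2 * Real.pi * iterConv O3half (n - 1) ℓ - ∫ θ : ℝ, Gs n x θ‖ ≤
      Real.exp (x * τ + 21 * (n * τ ^ 4)) * (Kc * (n:ℝ)⁻¹ *
        ∫ θ : ℝ, Real.exp (-(1 / 2000) * (n * θ ^ 4))) := by
  have hn0 : (0:ℝ) < n := by exact_mod_cast hn
  obtain ⟨hi, hs⟩ := Gs_shift n hn x τ
  rw [← hs, ← iter_formula τ n hn ℓ, ← hx,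
    intervalIntegral.integral_of_le (by linarith [Real.pi_pos]),
    ← integral_indicator measurableSet_Ioc, ← integral_sub]
  · have hint : Integrable (fun θ : ℝ => Real.exp (-(1 / 2000) * (n * θ ^ 4))) := by
      have := integrable_pow_exp4 0 (n / 2000) (by positivity)
      refine this.congr (Filter.Eventually.of_forall fun θ => ?_)
      simp only [pow_zero, one_mul]
      congr 1; ring
    rw [← integral_const_mul, ← integral_const_mul]
    refine norm_integral_le_of_norm_le ((hint.const_mul _).const_mul _)
      (Filter.Eventually.of_forall fun θ => ?_)
    have ha := absorb n hn θ τ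
    have e0 : Real.exp (x * τ + 21 * (n * τ ^ 4)) * (Kc * (n:ℝ)⁻¹ *
         Real.exp (-(1 / 2000) * (n * θ ^ 4))) = Real.exp (x * τ) * (Kc * (n:ℝ)⁻¹ *
         Real.exp (-(1 / 2000) * (n * θ ^ 4)) * Real.exp (21 * (n * τ ^ 4))) := by
      rw [Real.exp_add]; ring
    rw [e0]
    refine le_trans ?_ (mul_le_mul_of_nonneg_left ha (Real.exp_pos _).le)
    by_cases h : θ ∈ Set.Ioc (-Real.pi) Real.pi
    · rw [Set.indicator_of_mem h, Gs, ← mul_sub, norm_mul, norm_exp_x]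
      gcongr
      exact E_inner n hn θ τ (abs_le.mpr ⟨h.1.le, h.2⟩)
    · rw [Set.indicator_of_notMem h, zero_sub, norm_neg, Gs, norm_mul, norm_exp_x]
      gcongr
      refine E_outer n θ τ ?_ hn
      by_contra hc
      push Not at hc
      exact h ⟨(abs_lt.mp hc).1, (abs_lt.mp hc).2.le⟩
  · rw [integrable_indicator_iff measurableSet_Ioc]
    rw [← intervalIntegrable_iff_integrableOn_Ioc_of_le (by linarith [Real.pi_pos])]
    apply Continuous.intervalIntegrable
    unfold fsym
    fun_prop
  · exact hi

open MeasureTheory in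
lemma gauss_scale (n : ℕ) (hn : 1 ≤ n) :
    ∫ θ : ℝ, Real.exp (-(1 / 2000) * (n * θ ^ 4)) =
      (n:ℝ) ^ (-(1 : ℝ) / 4) * ∫ θ : ℝ, Real.exp (-(1 / 2000) * θ ^ 4) := by
  have hn0 : (0:ℝ) < n := by exact_mod_cast hn
  set N : ℝ := (n : ℝ) ^ ((1 : ℝ) / 4) with hN
  have hN0 : 0 < N := by positivity
  have hN4 : N ^ 4 = n := by
    rw [hN, ← Real.rpow_natCast, ← Real.rpow_mul hn0.le]; norm_num
  have hNm : (n : ℝ) ^ (-(1 : ℝ) / 4) = N⁻¹ := by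
    rw [hN, ← Real.rpow_neg hn0.le]; norm_num
  have := Measure.integral_comp_mul_left (fun θ : ℝ => Real.exp (-(1 / 2000) * θ ^ 4)) N
  rw [abs_of_pos (by positivity), smul_eq_mul] at this
  rw [hNm, ← this]
  congr 1
  ext θ
  rw [← hN4]
  congr 1; ring

lemma choose_tau (n : ℕ) (hn : 1 ≤ n) (x : ℝ) : ∃ τ : ℝ,
    x * τ + 21 * (n * τ ^ 4) ≤ -(1 / 8) * (|x| / (n:ℝ) ^ ((1:ℝ) / 4)) ^ ((4:ℝ) / 3) := by
  have hn0 : (0:ℝ) < n := by exact_mod_cast hn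
  set r : ℝ := (|x| / n) ^ ((1:ℝ) / 3) with hr
  have hq : 0 ≤ |x| / n := by positivity
  have hr3 : r ^ 3 = |x| / n := by
    rw [hr, ← Real.rpow_natCast, ← Real.rpow_mul hq]; norm_num
  have hx : |x| = n * r ^ 3 := by rw [hr3]; field_simp
  have hr0 : 0 ≤ r := by positivity
  have e : (|x| / (n:ℝ) ^ ((1:ℝ) / 4)) ^ ((4:ℝ) / 3) = n * r ^ 4 := by
    have h1 : |x| / (n:ℝ) ^ ((1:ℝ) / 4) = (n * r ^ 4) ^ ((3:ℝ) / 4) := by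
      rw [Real.mul_rpow hn0.le (by positivity), ← Real.rpow_natCast r 4, ← Real.rpow_mul hr0, hx]
      have h2 : (n:ℝ) = (n:ℝ) ^ ((3:ℝ) / 4) * (n:ℝ) ^ ((1:ℝ) / 4) := by
        rw [← Real.rpow_add hn0]; norm_num
      have h3 : r ^ (((4:ℕ):ℝ) * (3 / 4)) = r ^ 3 := by
        rw [← Real.rpow_natCast]; norm_num
      rw [h3]
      nth_rewrite 1 [h2]
      field_simp
    rw [h1, ← Real.rpow_mul (by positivity)]
    norm_num
  have hnr : 0 ≤ n * r ^ 4 := by positivity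
  rw [e]
  rcases le_total 0 x with h | h
  · refine ⟨-(1 / 4) * r, ?_⟩
    rw [abs_of_nonneg h] at hx
    rw [hx]
    nlinarith
  · refine ⟨(1 / 4) * r, ?_⟩
    rw [abs_of_nonpos h] at hx
    rw [show x = -(n * r ^ 3) by linarith]
    nlinarith

/-- Sharp two-term asymptotic expansion with generalized Gaussian remainder bound for the
iterated convolutions of the O3 scheme with `λ = 1/2`. -/
theorem O3half_asymptotic_expansion :
    ∃ C : ℝ, 0 < C ∧ ∃ c : ℝ, 0 < c ∧
      ∀ n : ℕ, 1 ≤ n → ∀ ℓ : ℤ,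
        ‖iterConv O3half (n - 1) ℓ -
            ((n : ℝ) ^ (-(1 : ℝ) / 4) : ℝ) *
              Hfun 2 (3 / 128) (((ℓ : ℝ) - n / 2) / (n : ℝ) ^ ((1 : ℝ) / 4)) +
            ((1 / (512 * (n : ℝ) ^ ((3 : ℝ) / 4)) : ℝ)) *
              iteratedDeriv 6 (Hfun 2 (3 / 128))
                (((ℓ : ℝ) - n / 2) / (n : ℝ) ^ ((1 : ℝ) / 4))‖ ≤
          C * (n : ℝ) ^ (-(5 : ℝ) / 4) *
            Real.exp (-c *
              (|(ℓ : ℝ) - n / 2| / (n : ℝ) ^ ((1 : ℝ) / 4)) ^ ((4 : ℝ) / 3)) := by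
  set Q : ℝ := ∫ θ : ℝ, Real.exp (-(1 / 2000) * θ ^ 4) with hQ
  have hQ0 : 0 ≤ Q := MeasureTheory.integral_nonneg fun θ => (Real.exp_pos _).le
  have hK : 0 ≤ Kc := by rw [Kc]; norm_num
  have hpi := Real.pi_pos
  refine ⟨Kc * Q / (2 * Real.pi) + 1, by positivity, 1 / 8, by norm_num, ?_⟩
  intro n hn ℓ
  have hn0 : (0:ℝ) < n := by exact_mod_cast hn
  obtain ⟨τ, hτ⟩ := choose_tau n hn ((ℓ:ℝ) - n / 2)
  have hb := main_bound n hn ℓ _ τ rfl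
  rw [Gs_integral n hn, gauss_scale n hn, ← mul_sub, norm_mul] at hb
  have n2 : ‖(2 * Real.pi : ℂ)‖ = 2 * Real.pi := by
    rw [norm_mul, Complex.norm_real, Real.norm_of_nonneg hpi.le]; norm_num
  have hpow : (n:ℝ)⁻¹ * (n:ℝ) ^ (-(1 : ℝ) / 4) = (n:ℝ) ^ (-(5 : ℝ) / 4) := by
    rw [← Real.rpow_neg_one, ← Real.rpow_add hn0]; norm_num
  rw [n2, ← sub_add, ← hQ] at hb
  have hE := Real.exp_le_exp.mpr hτ
  set Z := ‖iterConv O3half (n - 1) ℓ -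
            ((n : ℝ) ^ (-(1 : ℝ) / 4) : ℝ) *
              Hfun 2 (3 / 128) (((ℓ : ℝ) - n / 2) / (n : ℝ) ^ ((1 : ℝ) / 4)) +
            ((1 / (512 * (n : ℝ) ^ ((3 : ℝ) / 4)) : ℝ)) *
              iteratedDeriv 6 (Hfun 2 (3 / 128))
                (((ℓ : ℝ) - n / 2) / (n : ℝ) ^ ((1 : ℝ) / 4))‖
  set S := Real.exp (-(1 / 8) *
              (|(ℓ : ℝ) - n / 2| / (n : ℝ) ^ ((1 : ℝ) / 4)) ^ ((4 : ℝ) / 3))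
  have hS : 0 < S := Real.exp_pos _
  have h5 : 0 < (n:ℝ) ^ (-(5 : ℝ) / 4) := by positivity
  have hb2 : 2 * Real.pi * Z ≤ S * (Kc * Q * (n:ℝ) ^ (-(5 : ℝ) / 4)) := by
    refine hb.trans ?_
    rw [← hpow]
    calc _ ≤ S * (Kc * (n:ℝ)⁻¹ * ((n:ℝ) ^ (-(1 : ℝ) / 4) * Q)) := by gcongr
      _ = _ := by ring
  calc Z = (2 * Real.pi * Z) / (2 * Real.pi) := by field_simp
    _ ≤ (S * (Kc * Q * (n:ℝ) ^ (-(5 : ℝ) / 4))) / (2 * Real.pi) := by gcongr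
    _ = (Kc * Q / (2 * Real.pi)) * (n:ℝ) ^ (-(5 : ℝ) / 4) * S := by ring
    _ ≤ _ := by gcongr; linarith
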